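/- Let Ω ⊆ ℂ be a nonempty open connected set, and suppose there exists a C² function w : Ω → ℝ with Δw ≥ e^{2w} on Ω (that is, the conformal metric e^{2w}|dz|² has Gaussian curvature ≤ −1). Then there exists a holomorphic covering map from the open unit disk D₁ onto Ω, i.e. a holomorphic map f : D₁ → ℂ with f(D₁) = Ω which is a topological covering map onto Ω. -/

import Mathlib

/-- The Euclidean Laplacian of `u : ℂ → ℝ` on an (open) set `s`, computed via second
derivatives within `s` in the directions `1` and `I`. -/
noncomputable def laplacianOn (u : ℂ → ℝ) (s : Set ℂ) (z : ℂ) : ℝ :=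
  iteratedFDerivWithin ℝ 2 u s z ![1, 1] +
    iteratedFDerivWithin ℝ 2 u s z ![Complex.I, Complex.I]

/-- `f` is a holomorphic covering map from `D ⊆ ℂ` onto `Ω ⊆ ℂ`. -/
def IsHolomorphicCoveringOnto (f : ℂ → ℂ) (D Ω : Set ℂ) : Prop :=
  DifferentiableOn ℂ f D ∧ f '' D = Ω ∧
    ∀ h : Set.MapsTo f D Ω, IsCoveringMap (Set.MapsTo.restrict f D Ω h)

/-- A pointwise-limit form of Montel's theorem: along an ultrafilter, a locally bounded family of
holomorphic functions converges locally uniformly. -/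
theorem exists_tendstoLocallyUniformlyOn_of_locally_bounded {ι : Type*} (φ : Ultrafilter ι)
    {F : ι → ℂ → ℂ} {U : Set ℂ}
    (h : ∀ x ∈ U, ∃ r > 0, ∃ M : ℝ, ∀ᶠ n in (φ : Filter ι),
      DifferentiableOn ℂ (F n) (Metric.ball x r) ∧ ∀ z ∈ Metric.ball x r, ‖F n z‖ ≤ M) :
    ∃ f : ℂ → ℂ, TendstoLocallyUniformlyOn F f φ U := by
  have hlim : ∀ x ∈ U, ∃ y, Filter.Tendsto (fun n => F n x) φ (nhds y) := by
    intro x hx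
    obtain ⟨r, hr, M, hM⟩ := h x hx
    obtain ⟨y, -, hy⟩ := (isCompact_closedBall (0 : ℂ) M).ultrafilter_le_nhds
      (φ.map (fun n => F n x)) (by
        rw [Filter.le_principal_iff]
        exact hM.mono fun n hn => by simpa using hn.2 x (Metric.mem_ball_self hr))
    exact ⟨y, hy⟩
  choose! f hf using hlim
  refine ⟨f, Metric.tendstoLocallyUniformlyOn_iff.2 fun ε hε x hx => ?_⟩
  obtain ⟨r, hr, M, hM⟩ := h x hx
  have hM0 : 0 ≤ M := by
    obtain ⟨n, hn⟩ := hM.exists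
    exact (norm_nonneg _).trans (hn.2 x (Metric.mem_ball_self hr))
  have hlip : ∀ᶠ n in (φ : Filter ι), ∀ y ∈ Metric.ball x r,
      dist (F n y) (F n x) ≤ (2 * M) / r * dist y x := by
    filter_upwards [hM] with n hn y hy
    refine Complex.dist_le_div_mul_dist_of_mapsTo_ball hn.1 (fun z hz => ?_) hy
    rw [Metric.mem_closedBall, dist_eq_norm]
    have := norm_sub_le (F n z) (F n x)
    have := hn.2 z hz
    have := hn.2 x (Metric.mem_ball_self hr)
    linarith
  obtain ⟨δ, hδ, hδr, hδε⟩ : ∃ δ > 0, δ ≤ r ∧ (2 * M) / r * δ < ε / 3 := by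
    have hpos : (0 : ℝ) < 2 * M / r + 1 := by positivity
    refine ⟨min r (ε / 3 / (2 * M / r + 1) / 2), by positivity, min_le_left _ _, ?_⟩
    calc 2 * M / r * min r (ε / 3 / (2 * M / r + 1) / 2)
        ≤ (2 * M / r + 1) * (ε / 3 / (2 * M / r + 1) / 2) := by
          gcongr
          · linarith
          · exact min_le_right _ _
      _ = ε / 6 := by field_simp; ring
      _ < ε / 3 := by linarith
  refine ⟨Metric.ball x δ ∩ U, Filter.inter_mem
    (mem_nhdsWithin_of_mem_nhds (Metric.ball_mem_nhds x hδ)) self_mem_nhdsWithin, ?_⟩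
  have hbd : ∀ y ∈ Metric.ball x δ, (2 * M) / r * dist y x ≤ ε / 3 := fun y hy =>
    (mul_le_mul_of_nonneg_left (Metric.mem_ball.1 hy).le (by positivity)).trans hδε.le
  filter_upwards [hlip, (Metric.tendsto_nhds.1 (hf x hx)) (ε / 3) (by positivity)]
    with n hn hnx y hy
  have h1 : dist (f y) (f x) ≤ ε / 3 := by
    refine le_of_tendsto ((hf y hy.2).dist (hf x hx)) ?_
    filter_upwards [hlip] with m hm
    exact (hm y (Metric.ball_subset_ball hδr hy.1)).trans (hbd y hy.1)
  have h2 := (hn y (Metric.ball_subset_ball hδr hy.1)).trans (hbd y hy.1)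
  have h3 := dist_triangle4 (f y) (f x) (F n x) (F n y)
  rw [dist_comm (f x) (F n x), dist_comm (F n x) (F n y)] at h3
  linarith

theorem differentiableOn_of_tendstoLocallyUniformlyOn {ι : Type*} {φ : Filter ι} [φ.NeBot]
    {F : ι → ℂ → ℂ} {f : ℂ → ℂ} {U : Set ℂ} (hU : IsOpen U)
    (hlim : TendstoLocallyUniformlyOn F f φ U)
    (h : ∀ x ∈ U, ∃ r > 0, ∀ᶠ n in φ, DifferentiableOn ℂ (F n) (Metric.ball x r)) :
    DifferentiableOn ℂ f U := by
  intro x hx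
  obtain ⟨r, hr, hd⟩ := h x hx
  have := (hlim.mono (Set.inter_subset_left (t := Metric.ball x r))).differentiableOn
    (hd.mono fun n hn => hn.mono Set.inter_subset_right) (hU.inter Metric.isOpen_ball)
  exact ((this x ⟨hx, Metric.mem_ball_self hr⟩).differentiableAt
    ((hU.inter Metric.isOpen_ball).mem_nhds ⟨hx, Metric.mem_ball_self hr⟩)).differentiableWithinAt

/-- **Hurwitz's theorem**: a locally uniform limit of zero-free holomorphic functions on a connected
open set is zero-free unless it vanishes identically. -/
theorem ne_zero_of_tendstoLocallyUniformlyOn_of_ne_zero {ι : Type*} {φ : Filter ι} [φ.NeBot]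
    {F : ι → ℂ → ℂ} {f : ℂ → ℂ} {U : Set ℂ} (hU : IsOpen U) (hUc : IsPreconnected U)
    (hlim : TendstoLocallyUniformlyOn F f φ U)
    (h : ∀ x ∈ U, ∃ r > 0, ∀ᶠ n in φ, DifferentiableOn ℂ (F n) (Metric.ball x r) ∧
      ∀ z ∈ Metric.ball x r, F n z ≠ 0)
    (hne : ∃ z ∈ U, f z ≠ 0) {z : ℂ} (hz : z ∈ U) : f z ≠ 0 := by
  intro hfz
  have hfd : DifferentiableOn ℂ f U := differentiableOn_of_tendstoLocallyUniformlyOn hU hlim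
    fun x hx => (h x hx).imp fun r hr => ⟨hr.1, hr.2.mono fun n hn => hn.1⟩
  have han : AnalyticOnNhd ℂ f U := hfd.analyticOnNhd hU
  have hiso : ∀ᶠ y in nhdsWithin z {z}ᶜ, f y ≠ 0 := by
    refine (han z hz).eventually_eq_zero_or_eventually_ne_zero.resolve_left fun h0 => ?_
    obtain ⟨y, hy, hfy⟩ := hne
    exact hfy (han.eqOn_zero_of_preconnected_of_eventuallyEq_zero hUc hz h0 hy)
  obtain ⟨ρ, hρ, hF⟩ := h z hz
  obtain ⟨δ, hδ, hδU⟩ := Metric.isOpen_iff.1 hU z hz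
  obtain ⟨η, hη, hηf⟩ := Metric.mem_nhdsWithin_iff.1 hiso
  obtain ⟨R, hR, hRρ, hRδ, hRη⟩ : ∃ R > 0, R < ρ ∧ R < δ ∧ R < η :=
    ⟨min ρ (min δ η) / 2, by positivity, by
      have := min_le_left ρ (min δ η); have : 0 < min ρ (min δ η) := by positivity
      linarith, by
      have := (min_le_right ρ (min δ η)).trans (min_le_left _ _)
      have : 0 < min ρ (min δ η) := by positivity
      linarith, by
      have := (min_le_right ρ (min δ η)).trans (min_le_right _ _)
      have : 0 < min ρ (min δ η) := by positivity
      linarith⟩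
  have hSU : Metric.sphere z R ⊆ U := fun y hy => hδU (by
    rw [Metric.mem_sphere] at hy; rw [Metric.mem_ball, hy]; exact hRδ)
  have hS0 : ∀ y ∈ Metric.sphere z R, f y ≠ 0 := fun y hy => hηf ⟨by
    rw [Metric.mem_sphere] at hy; rw [Metric.mem_ball, hy]; exact hRη,
    Metric.ne_of_mem_sphere hy hR.ne'⟩
  obtain ⟨y₀, hy₀, hmin⟩ := (isCompact_sphere z R).exists_isMinOn
    (NormedSpace.sphere_nonempty.2 hR.le) (hfd.continuousOn.mono hSU).norm
  set c := ‖f y₀‖ with hc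
  have hc0 : 0 < c := norm_pos_iff.2 (hS0 y₀ hy₀)
  have hunif := (tendstoLocallyUniformlyOn_iff_tendstoUniformlyOn_of_compact
    (isCompact_sphere z R)).1 (hlim.mono hSU)
  have hpt : Filter.Tendsto (fun n => F n z) φ (nhds 0) := hfz ▸ hlim.tendsto_at hz
  obtain ⟨n, ⟨hnd, hn0⟩, hnS, hnz⟩ := (hF.and ((Metric.tendstoUniformlyOn_iff.1 hunif (c / 2)
    (by positivity)).and (Metric.tendsto_nhds.1 hpt (c / 2) (by positivity)))).exists
  have hcl : Metric.closedBall z R ⊆ Metric.ball z ρ := Metric.closedBall_subset_ball hRρ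
  have hmax := Complex.norm_le_of_forall_mem_frontier_norm_le (f := fun y => (F n y)⁻¹)
    (U := Metric.ball z R) Metric.isBounded_ball (C := 2 / c) (z := z)
    (DifferentiableOn.diffContOnCl (by
      rw [closure_ball z hR.ne']
      exact (hnd.mono hcl).inv fun y hy => hn0 y (hcl hy)))
    (by
      intro y hy
      rw [frontier_ball z hR.ne'] at hy
      have h1 := hnS y hy
      have h2 : c ≤ ‖f y‖ := hmin hy
      have h3 : ‖f y‖ - ‖F n y‖ ≤ dist (f y) (F n y) := by
        rw [dist_eq_norm]; exact norm_sub_norm_le _ _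
      rw [norm_inv, inv_eq_one_div, div_le_div_iff₀ (by linarith) hc0]
      linarith)
    (subset_closure (Metric.mem_ball_self hR))
  have h4 : 0 < ‖F n z‖ := norm_pos_iff.2 (hn0 z (Metric.mem_ball_self hρ))
  rw [norm_inv, inv_eq_one_div, div_le_div_iff₀ h4 hc0] at hmax
  rw [dist_zero_right] at hnz
  linarith

/-- `f` maps `U` holomorphically to `Ω`, and over every disk whose closure lies in `Ω` it has
holomorphic sections through all points of the preimage of the disk. -/
structure HasBallSections (f : ℂ → ℂ) (U Ω : Set ℂ) : Prop where
  differentiableOn : DifferentiableOn ℂ f U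
  mapsTo : Set.MapsTo f U Ω
  exists_section : ∀ c r, Metric.closedBall c r ⊆ Ω → ∀ z ∈ U, f z ∈ Metric.ball c r →
    ∃ g : ℂ → ℂ, DifferentiableOn ℂ g (Metric.ball c r) ∧ Set.MapsTo g (Metric.ball c r) U ∧
      (∀ y ∈ Metric.ball c r, f (g y) = y) ∧ g (f z) = z

namespace HasBallSections

/-- A holomorphic map into the closed unit disk which takes an interior value maps into the open
unit disk. -/
theorem mapsTo_ball_of_norm_le_one {g : ℂ → ℂ} {V : Set ℂ} (hV : IsOpen V) (hVc : IsPreconnected V)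
    (hg : DifferentiableOn ℂ g V) (hle : ∀ y ∈ V, ‖g y‖ ≤ 1) {y₀ : ℂ} (hy₀ : y₀ ∈ V)
    (hlt : ‖g y₀‖ < 1) : Set.MapsTo g V (Metric.ball 0 1) := by
  intro y hy
  rw [mem_ball_zero_iff]
  refine (hle y hy).lt_of_ne fun h1 => ?_
  have := Complex.norm_eqOn_of_isPreconnected_of_isMaxOn hVc hV hg hy
    (fun x hx => by simpa [h1] using hle x hx) hy₀
  simp only [Function.comp_apply, Function.const_apply] at this
  linarith

theorem of_tendstoLocallyUniformlyOn {ι : Type*} (φ : Ultrafilter ι) {f : ι → ℂ → ℂ}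
    {U V : ι → Set ℂ} {F : ℂ → ℂ} {Ω : Set ℂ} (hU1 : ∀ n, U n ⊆ Metric.ball 0 1)
    (hU : ∀ r < 1, ∀ᶠ n in (φ : Filter ι), Metric.ball 0 r ⊆ U n)
    (hf : ∀ n, HasBallSections (f n) (U n) (V n))
    (hV : ∀ c r, Metric.closedBall c r ⊆ Ω →
      ∀ᶠ n in (φ : Filter ι), Metric.closedBall c r ⊆ V n)
    (hlim : TendstoLocallyUniformlyOn f F φ (Metric.ball 0 1))
    (hmaps : Set.MapsTo F (Metric.ball 0 1) Ω) : HasBallSections F (Metric.ball 0 1) Ω := by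
  have hFd : DifferentiableOn ℂ F (Metric.ball 0 1) := by
    refine differentiableOn_of_tendstoLocallyUniformlyOn Metric.isOpen_ball hlim fun x hx => ?_
    rw [mem_ball_zero_iff] at hx
    refine ⟨(1 - ‖x‖) / 2, by linarith, (hU ((1 + ‖x‖) / 2) (by linarith)).mono fun n hn => ?_⟩
    refine (hf n).differentiableOn.mono (Set.Subset.trans (fun y hy => ?_) hn)
    rw [Metric.mem_ball, dist_eq_norm] at hy
    rw [mem_ball_zero_iff]
    have := norm_sub_norm_le y x
    linarith
  refine ⟨hFd, hmaps, fun c r hcr z hz hFz => ?_⟩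
  have hzU : ∀ᶠ n in (φ : Filter ι), z ∈ U n := by
    rw [mem_ball_zero_iff] at hz
    refine (hU ((1 + ‖z‖) / 2) (by linarith)).mono fun n hn => hn ?_
    rw [mem_ball_zero_iff]; linarith
  have hpt := hlim.tendsto_at hz
  have hzB : ∀ᶠ n in (φ : Filter ι), f n z ∈ Metric.ball c r :=
    hpt.eventually (Metric.isOpen_ball.mem_nhds hFz)
  have key : ∀ n, ∃ g : ℂ → ℂ, Metric.closedBall c r ⊆ V n → z ∈ U n → f n z ∈ Metric.ball c r →
      DifferentiableOn ℂ g (Metric.ball c r) ∧ Set.MapsTo g (Metric.ball c r) (U n) ∧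
      (∀ y ∈ Metric.ball c r, f n (g y) = y) ∧ g (f n z) = z := by
    intro n
    by_cases h : Metric.closedBall c r ⊆ V n ∧ z ∈ U n ∧ f n z ∈ Metric.ball c r
    · obtain ⟨g, hg⟩ := (hf n).exists_section c r h.1 z h.2.1 h.2.2
      exact ⟨g, fun _ _ _ => hg⟩
    · exact ⟨0, fun h1 h2 h3 => (h ⟨h1, h2, h3⟩).elim⟩
  choose g hg using key
  have hg' : ∀ᶠ n in (φ : Filter ι), DifferentiableOn ℂ (g n) (Metric.ball c r) ∧
      Set.MapsTo (g n) (Metric.ball c r) (U n) ∧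
      (∀ y ∈ Metric.ball c r, f n (g n y) = y) ∧ g n (f n z) = z := by
    filter_upwards [hV c r hcr, hzU, hzB] with n h1 h2 h3 using hg n h1 h2 h3
  have hloc : ∀ x ∈ Metric.ball c r, ∃ ρ > 0, ∃ M : ℝ, ∀ᶠ n in (φ : Filter ι),
      DifferentiableOn ℂ (g n) (Metric.ball x ρ) ∧ ∀ y ∈ Metric.ball x ρ, ‖g n y‖ ≤ M := by
    intro x hx
    obtain ⟨ρ, hρ, hsub⟩ := Metric.isOpen_iff.1 Metric.isOpen_ball x hx
    refine ⟨ρ, hρ, 1, hg'.mono fun n hn => ⟨hn.1.mono hsub, fun y hy => ?_⟩⟩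
    exact (mem_ball_zero_iff.1 (hU1 n (hn.2.1 (hsub hy)))).le
  obtain ⟨G, hG⟩ := exists_tendstoLocallyUniformlyOn_of_locally_bounded φ hloc
  have hGd : DifferentiableOn ℂ G (Metric.ball c r) :=
    hG.differentiableOn (hg'.mono fun n hn => hn.1) Metric.isOpen_ball
  have hGz : G (F z) = z := by
    have h1 : Filter.Tendsto (fun n => g n (f n z)) φ (nhds (G (F z))) :=
      hG.tendsto_comp (hGd.continuousOn (F z) hFz) hFz
        (tendsto_nhdsWithin_iff.2 ⟨hpt, hzB⟩)
    exact tendsto_nhds_unique h1 (tendsto_const_nhds.congr' (hg'.mono fun n hn => hn.2.2.2.symm))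
  have hGm : Set.MapsTo G (Metric.ball c r) (Metric.ball 0 1) := by
    refine mapsTo_ball_of_norm_le_one Metric.isOpen_ball
      (convex_ball c r).isPreconnected hGd (fun y hy => ?_) hFz
      (by rw [hGz]; exact mem_ball_zero_iff.1 hz)
    exact le_of_tendsto (hG.tendsto_at hy).norm
      (hg'.mono fun n hn => (mem_ball_zero_iff.1 (hU1 n (hn.2.1 hy))).le)
  refine ⟨G, hGd, hGm, fun y hy => ?_, hGz⟩
  have h1 : Filter.Tendsto (fun n => f n (g n y)) φ (nhds (F (G y))) :=
    hlim.tendsto_comp (hFd.continuousOn (G y) (hGm hy)) (hGm hy)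
      (tendsto_nhdsWithin_iff.2 ⟨hG.tendsto_at hy, hg'.mono fun n hn => hU1 n (hn.2.1 hy)⟩)
  exact tendsto_nhds_unique h1 (tendsto_const_nhds.congr' (hg'.mono fun n hn => (hn.2.2.1 y hy).symm))

variable {f : ℂ → ℂ} {U Ω : Set ℂ}

/-- A section over a disk centered at `f z`, together with the chain rule for it. -/
theorem exists_section_center (h : HasBallSections f U Ω) (hU : IsOpen U) {z : ℂ} (hz : z ∈ U)
    {r : ℝ} (hr : 0 < r) (hrΩ : Metric.closedBall (f z) r ⊆ Ω) :
    ∃ g : ℂ → ℂ, DifferentiableOn ℂ g (Metric.ball (f z) r) ∧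
      Set.MapsTo g (Metric.ball (f z) r) U ∧ (∀ y ∈ Metric.ball (f z) r, f (g y) = y) ∧
      g (f z) = z ∧ deriv f z * deriv g (f z) = 1 := by
  obtain ⟨g, hgd, hgm, hfg, hgz⟩ :=
    h.exists_section (f z) r hrΩ z hz (Metric.mem_ball_self hr)
  refine ⟨g, hgd, hgm, hfg, hgz, ?_⟩
  have hB : Metric.ball (f z) r ∈ nhds (f z) := Metric.ball_mem_nhds _ hr
  have h1 : HasDerivAt g (deriv g (f z)) (f z) := (hgd.differentiableAt hB).hasDerivAt
  have h2 : HasDerivAt f (deriv f z) (g (f z)) := by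
    rw [hgz]; exact (h.differentiableOn.differentiableAt (hU.mem_nhds hz)).hasDerivAt
  refine (h2.comp _ h1).unique ((hasDerivAt_id (f z)).congr_of_eventuallyEq ?_)
  filter_upwards [hB] with y hy using hfg y hy

theorem deriv_ne_zero (h : HasBallSections f U Ω) (hU : IsOpen U) (hΩ : IsOpen Ω) {z : ℂ}
    (hz : z ∈ U) : deriv f z ≠ 0 := by
  obtain ⟨r, hr, hrΩ⟩ := Metric.nhds_basis_closedBall.mem_iff.1 (hΩ.mem_nhds (h.mapsTo hz))
  obtain ⟨g, -, -, -, -, hg⟩ := h.exists_section_center hU hz hr hrΩ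
  exact left_ne_zero_of_mul_eq_one hg

theorem le_norm_deriv (h : HasBallSections f U Ω) (hU : IsOpen U) (hU1 : U ⊆ Metric.ball 0 1)
    (h0 : (0 : ℂ) ∈ U) {r : ℝ} (hr : 0 < r) (hrΩ : Metric.closedBall (f 0) r ⊆ Ω) :
    r ≤ ‖deriv f 0‖ := by
  obtain ⟨g, hgd, hgm, -, hg0, hg⟩ := h.exists_section_center hU h0 hr hrΩ
  have h1 : ‖deriv g (f 0)‖ ≤ 1 / r := by
    refine Complex.norm_deriv_le_div_of_mapsTo_ball hgd (fun y hy => ?_) hr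
    rw [hg0]
    exact Metric.ball_subset_closedBall (hU1 (hgm hy))
  have h2 : ‖deriv f 0‖ * ‖deriv g (f 0)‖ = 1 := by rw [← norm_mul, hg, norm_one]
  have h3 : ‖deriv f 0‖ * ‖deriv g (f 0)‖ ≤ ‖deriv f 0‖ * (1 / r) := by gcongr
  rw [h2, mul_one_div, le_div_iff₀ hr] at h3
  linarith

end HasBallSections

/-- On a disk, a zero-free holomorphic function has a holomorphic logarithm. -/
theorem exists_holomorphic_log_ball {f : ℂ → ℂ} {c : ℂ} {r : ℝ}
    (hf : DifferentiableOn ℂ f (Metric.ball c r)) (h0 : ∀ z ∈ Metric.ball c r, f z ≠ 0) :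
    ∃ l : ℂ → ℂ, DifferentiableOn ℂ l (Metric.ball c r) ∧
      ∀ z ∈ Metric.ball c r, Complex.exp (l z) = f z := by
  rcases le_or_gt r 0 with hr | hr
  · rw [Metric.ball_eq_empty.2 hr]
    exact ⟨0, differentiableOn_empty, fun _ h => h.elim⟩
  have hc : c ∈ Metric.ball c r := Metric.mem_ball_self hr
  have hd : DifferentiableOn ℂ (fun z => deriv f z / f z) (Metric.ball c r) :=
    (hf.deriv Metric.isOpen_ball).div hf h0
  obtain ⟨l, hlc, hl⟩ := hd.isExactOn_ball.with_val_at c (Complex.log (f c))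
  refine ⟨l, fun z hz => (hl z hz).differentiableAt.differentiableWithinAt, fun z hz => ?_⟩
  have hder : ∀ z ∈ Metric.ball c r,
      HasDerivAt (fun z => f z * Complex.exp (-l z)) 0 z := by
    intro z hz
    have h1 := (hf.differentiableAt (Metric.isOpen_ball.mem_nhds hz)).hasDerivAt
    refine (h1.mul (hl z hz).neg.cexp).congr_deriv ?_
    have h2 : f z * (deriv f z / f z) = deriv f z := mul_div_cancel₀ _ (h0 z hz)
    linear_combination -Complex.exp (-l z) * h2
  have hconst := Metric.isOpen_ball.is_const_of_deriv_eq_zero (convex_ball c r).isPreconnected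
    (f := fun z => f z * Complex.exp (-l z))
    (fun z hz => (hder z hz).differentiableAt.differentiableWithinAt)
    (fun z hz => (hder z hz).deriv) hz hc
  simp only [hlc, Complex.exp_neg, Complex.exp_log (h0 c hc), mul_inv_cancel₀ (h0 c hc)] at hconst
  exact ((mul_inv_eq_one₀ (Complex.exp_ne_zero _)).1 hconst).symm

/-- The involutive automorphism of the unit disk exchanging `0` and `b`. -/
noncomputable def diskInvolution (b z : ℂ) : ℂ := (b - z) / (1 - (starRingEnd ℂ) b * z)

namespace diskInvolution

variable {b z : ℂ}

theorem denom_ne_zero (hb : ‖b‖ < 1) (hz : ‖z‖ < 1) : 1 - (starRingEnd ℂ) b * z ≠ 0 := by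
  intro h
  have h1 : ‖(starRingEnd ℂ) b * z‖ = 1 := by rw [← sub_eq_zero.1 h, norm_one]
  rw [norm_mul, RCLike.norm_conj] at h1
  nlinarith [norm_nonneg b, norm_nonneg z]

theorem norm_lt_one (hb : ‖b‖ < 1) (hz : ‖z‖ < 1) : ‖diskInvolution b z‖ < 1 := by
  have hd := denom_ne_zero hb hz
  rw [diskInvolution, norm_div, div_lt_one (norm_pos_iff.2 hd)]
  refine lt_of_pow_lt_pow_left₀ 2 (norm_nonneg _) ?_
  have key : ‖1 - (starRingEnd ℂ) b * z‖ ^ 2 - ‖b - z‖ ^ 2 = (1 - ‖b‖ ^ 2) * (1 - ‖z‖ ^ 2) := by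
    simp only [Complex.sq_norm, Complex.normSq_apply]
    simp
    ring
  have : 0 < (1 - ‖b‖ ^ 2) * (1 - ‖z‖ ^ 2) := by
    have := norm_nonneg b
    have := norm_nonneg z
    apply mul_pos <;> nlinarith
  linarith

theorem apply_apply (hb : ‖b‖ < 1) (hz : ‖z‖ < 1) :
    diskInvolution b (diskInvolution b z) = z := by
  have hd := denom_ne_zero hb hz
  have hd' := denom_ne_zero hb (norm_lt_one hb hz)
  have key : diskInvolution b z * (1 - (starRingEnd ℂ) b * z) = b - z := div_mul_cancel₀ _ hd
  rw [diskInvolution, div_eq_iff hd']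
  refine mul_right_cancel₀ hd ?_
  linear_combination (-1 + (starRingEnd ℂ) b * z) * key

@[simp] theorem apply_zero : diskInvolution b 0 = b := by simp [diskInvolution]

@[simp] theorem apply_self : diskInvolution b b = 0 := by simp [diskInvolution]

theorem ne_zero (hb : ‖b‖ < 1) (hz : ‖z‖ < 1) (hne : z ≠ b) : diskInvolution b z ≠ 0 :=
  div_ne_zero (sub_ne_zero.2 hne.symm) (denom_ne_zero hb hz)

theorem hasDerivAt (hb : ‖b‖ < 1) (hz : ‖z‖ < 1) :
    HasDerivAt (diskInvolution b)
      ((-(1 - (starRingEnd ℂ) b * z) + (b - z) * (starRingEnd ℂ) b) /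
        (1 - (starRingEnd ℂ) b * z) ^ 2) z := by
  have h1 : HasDerivAt (fun z => b - z) (-1) z := (hasDerivAt_id z).const_sub b
  have h2 : HasDerivAt (fun z => 1 - (starRingEnd ℂ) b * z) (-(starRingEnd ℂ) b) z := by
    simpa using ((hasDerivAt_id z).const_mul ((starRingEnd ℂ) b)).const_sub 1
  refine (h1.div h2 (denom_ne_zero hb hz)).congr_deriv ?_
  ring

theorem differentiableOn (hb : ‖b‖ < 1) :
    DifferentiableOn ℂ (diskInvolution b) (Metric.ball 0 1) := fun _ hz =>
  (hasDerivAt hb (mem_ball_zero_iff.1 hz)).differentiableAt.differentiableWithinAt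

theorem hasDerivAt_zero (hb : ‖b‖ < 1) :
    HasDerivAt (diskInvolution b) (((‖b‖ ^ 2 - 1 : ℝ) : ℂ)) 0 := by
  convert hasDerivAt hb (z := 0) (by simp) using 1
  push_cast
  rw [← Complex.mul_conj']
  ring

theorem hasDerivAt_self (hb : ‖b‖ < 1) :
    HasDerivAt (diskInvolution b) (((-1 / (1 - ‖b‖ ^ 2) : ℝ) : ℂ)) b := by
  convert hasDerivAt hb hb using 1
  have := denom_ne_zero hb hb
  push_cast
  rw [← Complex.mul_conj']
  rw [mul_comm b]
  field_simp
  ring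

end diskInvolution

/-- **Koebe's square root transform**: if `U` misses the point `b` of the unit disk, then the domain
of a map with local sections can be replaced by a double cover, which decreases the derivative at the
origin by an explicit factor. -/
theorem HasBallSections.exists_koebe_transform {f : ℂ → ℂ} {U Ω : Set ℂ}
    (h : HasBallSections f U Ω) (hU : IsOpen U) (hU1 : U ⊆ Metric.ball 0 1) (h0 : (0 : ℂ) ∈ U)
    {b : ℂ} (hb : ‖b‖ < 1) (hbU : b ∉ U) :
    ∃ (F : ℂ → ℂ) (V : Set ℂ), IsOpen V ∧ V ⊆ Metric.ball 0 1 ∧ 0 ∈ V ∧ HasBallSections F V Ω ∧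
      F 0 = f 0 ∧ ‖deriv F 0‖ = ‖deriv f 0‖ * (2 * √‖b‖ / (1 + ‖b‖)) := by
  obtain ⟨s, hs⟩ := IsAlgClosed.exists_pow_nat_eq b two_pos
  have hsb : ‖s‖ ^ 2 = ‖b‖ := by rw [← norm_pow, hs]
  have hs1 : ‖s‖ < 1 := by
    have := norm_nonneg s
    nlinarith
  set q : ℂ → ℂ := fun z => diskInvolution b (diskInvolution s z ^ 2) with hq
  have hsq : ∀ z, ‖z‖ < 1 → ‖diskInvolution s z ^ 2‖ < 1 := fun z hz => by
    rw [norm_pow]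
    exact pow_lt_one₀ (norm_nonneg _) (diskInvolution.norm_lt_one hs1 hz) two_ne_zero
  have hqd : DifferentiableOn ℂ q (Metric.ball 0 1) :=
    (diskInvolution.differentiableOn hb).comp ((diskInvolution.differentiableOn hs1).pow 2)
      fun z hz => mem_ball_zero_iff.2 (hsq z (mem_ball_zero_iff.1 hz))
  have hq0 : q 0 = 0 := by simp [hq, hs]
  have hqV : Set.MapsTo q (Metric.ball 0 1 ∩ q ⁻¹' U) U := fun z hz => hz.2
  refine ⟨f ∘ q, Metric.ball 0 1 ∩ q ⁻¹' U,
    hqd.continuousOn.isOpen_inter_preimage Metric.isOpen_ball hU, Set.inter_subset_left,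
    ⟨Metric.mem_ball_self one_pos, by simpa [hq0] using h0⟩,
    ⟨h.differentiableOn.comp (hqd.mono Set.inter_subset_left) hqV, h.mapsTo.comp hqV, ?_⟩,
    by simp [hq0], ?_⟩
  · intro c r hcr z hz hfz
    obtain ⟨g, hgd, hgm, hfg, hgz⟩ := h.exists_section c r hcr (q z) hz.2 hfz
    have hg1 : ∀ y ∈ Metric.ball c r, ‖g y‖ < 1 := fun y hy =>
      mem_ball_zero_iff.1 (hU1 (hgm hy))
    obtain ⟨l, hld, hl⟩ := exists_holomorphic_log_ball
      ((diskInvolution.differentiableOn hb).comp hgd fun y hy => hU1 (hgm hy))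
      (fun y hy => diskInvolution.ne_zero hb (hg1 y hy)
        fun hgb => hbU (hgb ▸ hgm hy))
    have hz1 : ‖z‖ < 1 := mem_ball_zero_iff.1 hz.1
    obtain ⟨k, hkd, hk2, hkz⟩ : ∃ k : ℂ → ℂ, DifferentiableOn ℂ k (Metric.ball c r) ∧
        (∀ y ∈ Metric.ball c r, k y ^ 2 = diskInvolution b (g y)) ∧
        k (f (q z)) = diskInvolution s z := by
      have hsqr : ∀ y ∈ Metric.ball c r,
          Complex.exp (l y / 2) ^ 2 = diskInvolution b (g y) := fun y hy => by
        have h1 : Complex.exp (l y) = diskInvolution b (g y) := hl y hy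
        rw [← Complex.exp_nat_mul, ← h1]
        congr 1
        push_cast
        ring
      have hexp : DifferentiableOn ℂ (fun y => Complex.exp (l y / 2)) (Metric.ball c r) :=
        (hld.div_const 2).cexp
      have hpm : Complex.exp (l (f (q z)) / 2) ^ 2 = diskInvolution s z ^ 2 := by
        rw [hsqr (f (q z)) hfz, hgz]
        exact diskInvolution.apply_apply hb (hsq z hz1)
      rcases sq_eq_sq_iff_eq_or_eq_neg.1 hpm with h1 | h1
      · exact ⟨_, hexp, hsqr, h1⟩
      · refine ⟨fun y => -Complex.exp (l y / 2), hexp.neg, fun y hy => ?_, ?_⟩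
        · rw [neg_sq, hsqr y hy]
        · simp only [h1, neg_neg]
    have hk1 : ∀ y ∈ Metric.ball c r, ‖k y‖ < 1 := fun y hy => by
      have h1 : ‖k y‖ ^ 2 < 1 := by
        rw [← norm_pow, hk2 y hy]; exact diskInvolution.norm_lt_one hb (hg1 y hy)
      nlinarith [norm_nonneg (k y)]
    have hqG : ∀ y ∈ Metric.ball c r, q (diskInvolution s (k y)) = g y := fun y hy => by
      simp only [hq]
      rw [diskInvolution.apply_apply hs1 (hk1 y hy), hk2 y hy,
        diskInvolution.apply_apply hb (hg1 y hy)]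
    refine ⟨fun y => diskInvolution s (k y), (diskInvolution.differentiableOn hs1).comp hkd
      fun y hy => mem_ball_zero_iff.2 (hk1 y hy), fun y hy => ⟨?_, ?_⟩, fun y hy => ?_, ?_⟩
    · exact mem_ball_zero_iff.2 (diskInvolution.norm_lt_one hs1 (hk1 y hy))
    · simpa only [Set.mem_preimage, hqG y hy] using hgm hy
    · simp only [Function.comp_apply, hqG y hy, hfg y hy]
    · simp only [Function.comp_apply, hkz]
      exact diskInvolution.apply_apply hs1 hz1
  · have h1 := (diskInvolution.hasDerivAt_zero hs1).fun_pow 2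
    have h2 : HasDerivAt (diskInvolution b) (((-1 / (1 - ‖b‖ ^ 2) : ℝ) : ℂ))
        (diskInvolution s 0 ^ 2) := by
      simpa [hs] using diskInvolution.hasDerivAt_self hb
    have h3 : HasDerivAt f (deriv f 0) (q 0) := by
      rw [hq0]; exact (h.differentiableOn.differentiableAt (hU.mem_nhds h0)).hasDerivAt
    have h5 := HasDerivAt.comp (h := fun z => diskInvolution s z ^ 2) 0 h2 h1
    have h4 := HasDerivAt.comp (h := q) 0 h3 h5
    rw [HasDerivAt.deriv h4, norm_mul, norm_mul, norm_mul, Complex.norm_real, Complex.norm_real]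
    have hsn := norm_nonneg s
    congr 1
    have h5 : √‖b‖ = ‖s‖ := by rw [← hsb, Real.sqrt_sq hsn]
    have h6 : 0 < 1 - ‖s‖ ^ 2 := by nlinarith
    have h7 : 0 < 1 - (‖s‖ ^ 2) ^ 2 := by nlinarith
    rw [h5, ← hsb]
    simp only [diskInvolution.apply_zero, Real.norm_eq_abs]
    rw [abs_div, abs_neg, abs_one, abs_of_pos h7, abs_sub_comm, abs_of_pos h6]
    have h8 : 1 - (‖s‖ ^ 2) ^ 2 = (1 - ‖s‖ ^ 2) * (1 + ‖s‖ ^ 2) := by ring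
    rw [h8]
    simp
    field_simp

theorem TendstoLocallyUniformlyOn.sub_tendsto_const {ι : Type*} {φ : Filter ι}
    {F : ι → ℂ → ℂ} {f : ℂ → ℂ} {U : Set ℂ} (hlim : TendstoLocallyUniformlyOn F f φ U)
    {c : ι → ℂ} {c₀ : ℂ} (hc : Filter.Tendsto c φ (nhds c₀)) :
    TendstoLocallyUniformlyOn (fun n z => F n z - c n) (fun z => f z - c₀) φ U := by
  rw [Metric.tendstoLocallyUniformlyOn_iff] at hlim ⊢
  intro ε hε x hx
  obtain ⟨t, ht, h⟩ := hlim (ε / 2) (half_pos hε) x hx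
  refine ⟨t, ht, ?_⟩
  filter_upwards [h, Metric.tendsto_nhds.1 hc (ε / 2) (half_pos hε)] with n h1 h2 y hy
  calc dist (f y - c₀) (F n y - c n) ≤ dist (f y) (F n y) + dist c₀ (c n) := dist_sub_sub_le _ _ _ _
    _ < ε / 2 + ε / 2 := add_lt_add (h1 y hy) (by rwa [dist_comm])
    _ = ε := add_halves ε

theorem HasBallSections.id (Ω : Set ℂ) : HasBallSections id Ω Ω :=
  ⟨differentiableOn_id, Set.mapsTo_id _, fun _ _ hcr _ _ _ =>
    ⟨_root_.id, differentiableOn_id, fun _ hy => hcr (Metric.ball_subset_closedBall hy),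
      fun _ _ => rfl, rfl⟩⟩

theorem exists_eventually_ball_subset {ι : Type*} {φ : Filter ι} {U : ι → Set ℂ}
    (hU : ∀ r < 1, ∀ᶠ n in φ, Metric.ball 0 r ⊆ U n) {x : ℂ} (hx : x ∈ Metric.ball (0 : ℂ) 1) :
    ∃ r > 0, ∀ᶠ n in φ, Metric.ball x r ⊆ U n := by
  rw [mem_ball_zero_iff] at hx
  refine ⟨(1 - ‖x‖) / 2, by linarith, (hU ((1 + ‖x‖) / 2) (by linarith)).mono fun n hn => ?_⟩
  exact (Metric.ball_subset_ball' (by rw [dist_zero_right]; linarith)).trans hn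

theorem exists_hasBallSections_of_subset_ball_one {Ω : Set ℂ} (hΩ : IsOpen Ω)
    (h1 : Ω ⊆ Metric.ball 0 1) (h0 : (0 : ℂ) ∈ Ω) :
    ∃ f : ℂ → ℂ, HasBallSections f (Metric.ball 0 1) Ω ∧ f 0 = 0 := by
  let P : ℝ → (ℂ → ℂ) → Set ℂ → Prop := fun d f U => IsOpen U ∧ U ⊆ Metric.ball 0 1 ∧ 0 ∈ U ∧
    f 0 = 0 ∧ HasBallSections f U Ω ∧ ‖deriv f 0‖ = d
  let S : Set ℝ := {d | ∃ f U, P d f U}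
  have hS : S.Nonempty := ⟨_, _root_.id, Ω, hΩ, h1, h0, rfl, HasBallSections.id Ω, rfl⟩
  obtain ⟨ρ, hρ, hρΩ⟩ := Metric.nhds_basis_closedBall.mem_iff.1 (hΩ.mem_nhds h0)
  have hlb : ∀ d ∈ S, ρ ≤ d := by
    rintro d ⟨f, U, hU, hU1, hU0, hf0, hf, rfl⟩
    exact hf.le_norm_deriv hU hU1 hU0 hρ (by rwa [hf0])
  have hbdd : BddBelow S := ⟨ρ, hlb⟩
  set m := sInf S with hm
  have hm0 : 0 < m := hρ.trans_le (le_csInf hS hlb)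
  have hex : ∀ n : ℕ, ∃ (f : ℂ → ℂ) (U : Set ℂ) (d : ℝ), P d f U ∧ d < m + 1 / ((n : ℝ) + 1) := by
    intro n
    obtain ⟨d, ⟨f, U, hP⟩, hd⟩ := exists_lt_of_csInf_lt hS
      (show sInf S < m + 1 / ((n : ℝ) + 1) from lt_add_of_pos_right _ Nat.one_div_pos_of_nat)
    exact ⟨f, U, d, hP, hd⟩
  choose f U d hP hd using hex
  have hU : ∀ r < 1, ∀ᶠ n in Filter.atTop, Metric.ball 0 r ⊆ U n := by
    intro r hr
    rcases le_or_gt r 0 with hr0 | hr0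
    · simp [Metric.ball_eq_empty.2 hr0]
    have hsr : √r < 1 := by rwa [Real.sqrt_lt' one_pos, one_pow]
    set δ := (1 - √r) ^ 2 / 2 with hδ
    have hδ0 : 0 < δ := by have : 0 < 1 - √r := by linarith
                           positivity
    have hlim : Filter.Tendsto (fun n : ℕ => (m + 1 / ((n : ℝ) + 1)) * (1 - δ)) Filter.atTop
        (nhds ((m + 0) * (1 - δ))) :=
      (tendsto_const_nhds.add tendsto_one_div_add_atTop_nhds_zero_nat).mul_const _
    filter_upwards [hlim.eventually_lt_const (show (m + 0) * (1 - δ) < m by nlinarith)] with n hn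
    intro b hb
    by_contra hbU
    obtain ⟨hUo, hU1, hU0, hf0, hf, hdn⟩ := hP n
    rw [mem_ball_zero_iff] at hb
    obtain ⟨F, V, hV, hV1, hV0, hF, hF0, hFd⟩ :=
      hf.exists_koebe_transform hUo hU1 hU0 (hb.trans hr) hbU
    have hle : m ≤ d n * (2 * √‖b‖ / (1 + ‖b‖)) :=
      csInf_le hbdd ⟨F, V, hV, hV1, hV0, hF0.trans hf0, hF, by rw [hFd, hdn]⟩
    have hκ : 2 * √‖b‖ / (1 + ‖b‖) ≤ 1 - δ := by
      have hb0 := norm_nonneg b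
      have hs0 := Real.sqrt_nonneg ‖b‖
      have hs1 : √‖b‖ ≤ √r := Real.sqrt_le_sqrt hb.le
      have hs2 := Real.sq_sqrt hb0
      rw [div_le_iff₀ (by linarith), hδ]
      have h3 : (1 - √r) ^ 2 ≤ (1 - √‖b‖) ^ 2 := by
        apply pow_le_pow_left₀ <;> linarith
      have h4 : (1 - √r) ^ 2 / 2 * (1 + ‖b‖) ≤ (1 - √r) ^ 2 := by
        have := sq_nonneg (1 - √r)
        nlinarith
      nlinarith
    have hκ0 : 0 ≤ 2 * √‖b‖ / (1 + ‖b‖) := by positivity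
    have : d n * (2 * √‖b‖ / (1 + ‖b‖)) ≤ (m + 1 / ((n : ℝ) + 1)) * (1 - δ) :=
      mul_le_mul (hd n).le hκ hκ0 (by positivity)
    linarith
  let φ : Ultrafilter ℕ := Filter.hyperfilter ℕ
  have hφ : (φ : Filter ℕ) ≤ Filter.atTop := Nat.cofinite_eq_atTop ▸ Filter.hyperfilter_le_cofinite
  have hUφ : ∀ r < 1, ∀ᶠ n in (φ : Filter ℕ), Metric.ball 0 r ⊆ U n := fun r hr => hφ (hU r hr)
  obtain ⟨F, hF⟩ := exists_tendstoLocallyUniformlyOn_of_locally_bounded φ (F := f)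
    (U := Metric.ball 0 1) fun x hx => by
      obtain ⟨r, hr, h⟩ := exists_eventually_ball_subset hUφ hx
      exact ⟨r, hr, 1, h.mono fun n hn => ⟨(hP n).2.2.2.2.1.differentiableOn.mono hn, fun z hz =>
        (mem_ball_zero_iff.1 (h1 ((hP n).2.2.2.2.1.mapsTo (hn hz)))).le⟩⟩
  have hF0 : F 0 = 0 := tendsto_nhds_unique (hF.tendsto_at (Metric.mem_ball_self one_pos))
    (by simp only [(hP _).2.2.2.1]; exact tendsto_const_nhds)
  refine ⟨F, HasBallSections.of_tendstoLocallyUniformlyOn φ (fun n => (hP n).2.1) hUφ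
    (fun n => (hP n).2.2.2.2.1) (fun c r h => Filter.Eventually.of_forall fun _ => h) hF ?_, hF0⟩
  intro z hz
  by_contra hb
  refine ne_zero_of_tendstoLocallyUniformlyOn_of_ne_zero Metric.isOpen_ball
    (convex_ball (0 : ℂ) 1).isPreconnected (hF.sub_tendsto_const
      (tendsto_const_nhds (x := F z))) (fun x hx => ?_)
    ⟨0, Metric.mem_ball_self one_pos, ?_⟩ hz (sub_self _)
  · obtain ⟨r, hr, h⟩ := exists_eventually_ball_subset hUφ hx
    refine ⟨r, hr, h.mono fun n hn => ⟨((hP n).2.2.2.2.1.differentiableOn.mono hn).sub_const _,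
      fun y hy hfy => hb ?_⟩⟩
    rw [← sub_eq_zero.1 hfy]
    exact (hP n).2.2.2.2.1.mapsTo (hn hy)
  · intro h
    rw [hF0, sub_eq_zero] at h
    exact hb (h ▸ h0)

/-- Every point of a bounded open set is the image of the origin under a map from the unit disk which
has holomorphic sections over disks. -/
theorem exists_hasBallSections_of_isBounded {Ω : Set ℂ} (hΩ : IsOpen Ω)
    (hb : Bornology.IsBounded Ω) {a : ℂ} (ha : a ∈ Ω) :
    ∃ f : ℂ → ℂ, HasBallSections f (Metric.ball 0 1) Ω ∧ f 0 = a := by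
  obtain ⟨R, hR⟩ := hb.subset_ball a
  have hR0 : 0 < R := Metric.pos_of_mem_ball (hR ha)
  have hRc : (R : ℂ) ≠ 0 := by exact_mod_cast hR0.ne'
  obtain ⟨f, hf, hf0⟩ := exists_hasBallSections_of_subset_ball_one
    (Ω := (fun z : ℂ => a + R * z) ⁻¹' Ω) (hΩ.preimage (by fun_prop)) (fun z hz => by
      have := hR hz
      rw [mem_ball_iff_norm, add_sub_cancel_left, norm_mul, Complex.norm_real,
        Real.norm_of_nonneg hR0.le] at this
      rw [mem_ball_zero_iff]
      nlinarith) (by simpa using ha)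
  have hball : ∀ c y : ℂ, dist ((y - a) / R) ((c - a) / R) * R = dist y c := by
    intro c y
    rw [dist_eq_norm, ← sub_div, norm_div, Complex.norm_real, Real.norm_of_nonneg hR0.le,
      sub_sub_sub_cancel_right, dist_eq_norm, div_mul_cancel₀ _ hR0.ne']
  refine ⟨fun z => a + R * f z, ⟨(hf.differentiableOn.const_mul _).const_add _, hf.mapsTo,
    fun c r hcr z hz hfz => ?_⟩, by simp [hf0]⟩
  have hmem : ∀ y, y ∈ Metric.ball c r → (y - a) / R ∈ Metric.ball ((c - a) / R) (r / R) := by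
    intro y hy
    rw [Metric.mem_ball, lt_div_iff₀ hR0, hball c y]
    exact hy
  have hfz' : (a + R * f z - a) / R = f z := by field_simp; ring
  obtain ⟨g, hgd, hgm, hfg, hgz⟩ := hf.exists_section ((c - a) / R) (r / R) (fun y hy => hcr (by
      rw [Metric.mem_closedBall, le_div_iff₀ hR0] at hy
      have h2 : (a + R * y - a) / R = y := by field_simp; ring
      rwa [Metric.mem_closedBall, ← hball c _, h2])) z hz (by
      have := hmem _ hfz
      rwa [hfz'] at this)
  refine ⟨fun y => g ((y - a) / R), hgd.comp (by fun_prop) hmem, fun y hy => hgm (hmem y hy),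
    fun y hy => ?_, ?_⟩
  · simp only [hfg _ (hmem y hy)]
    field_simp
    ring
  · simp only [hfz', hgz]

/-- A locally injective separated map with enough continuous local sections is a covering map. -/
theorem isCoveringMap_of_exists_section {E X : Type*} [TopologicalSpace E] [TopologicalSpace X]
    {p : E → X} (hp : Continuous p) (hsep : IsSeparatedMap p) (hinj : IsLocallyInjective p)
    (h : ∀ x, ∃ V : Set X, IsOpen V ∧ x ∈ V ∧ IsPreconnected V ∧ ∀ e (he : p e ∈ V),
      ∃ s : V → E, Continuous s ∧ (∀ y, p (s y) = y) ∧ s ⟨p e, he⟩ = e) :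
    IsCoveringMap p := by
  intro x
  obtain ⟨V, hV, hxV, hVc, hs⟩ := h x
  have : PreconnectedSpace V := isPreconnected_iff_preconnectedSpace.1 hVc
  choose s hsc hps hse using hs
  have heq : ∀ t₁ t₂ : V → E, Continuous t₁ → Continuous t₂ → (∀ y, p (t₁ y) = y) →
      (∀ y, p (t₂ y) = y) → ∀ y, t₁ y = t₂ y → t₁ = t₂ := fun t₁ t₂ h₁ h₂ hp₁ hp₂ y hy =>
    hsep.eq_of_comp_eq hinj h₁ h₂ (funext fun y => (hp₁ y).trans (hp₂ y).symm) y hy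
  have hdisc : DiscreteTopology (p ⁻¹' {x}) := by
    rw [discreteTopology_iff_locallyInjective x]
    convert hinj.comp_right (g := ((↑) : p ⁻¹' {x} → E)) continuous_subtype_val
      Subtype.val_injective using 1
    exact funext fun e => e.2.symm
  have hfib : ∀ e : p ⁻¹' {x}, p e ∈ V := fun e => by
    have : p e = x := e.2
    rwa [this]
  have hval : ∀ e : p ⁻¹' {x}, s e (hfib e) ⟨x, hxV⟩ = e := fun e => by
    have h1 : (⟨x, hxV⟩ : V) = ⟨p e, hfib e⟩ := Subtype.ext (show x = p e from e.2.symm)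
    rw [h1, hse]
  have hse' : ∀ e (he : p e ∈ V) (y : V), p e = y → s e he y = e := by
    rintro e he ⟨y, hy⟩ rfl
    exact hse e he
  have hback : ∀ e : p ⁻¹' V,
      s (s e e.2 ⟨x, hxV⟩) (by rw [hps]; exact hxV) = s e e.2 := fun e =>
    heq _ _ (hsc _ _) (hsc _ _) (hps _ _) (hps _ _) ⟨x, hxV⟩ (by
      exact hval ⟨s e e.2 ⟨x, hxV⟩, hps _ _ _⟩)
  refine ⟨hdisc, V, hxV, hV, hV.preimage hp,
    { toFun := fun e => ⟨⟨p e, e.2⟩, ⟨s e e.2 ⟨x, hxV⟩, hps _ _ _⟩⟩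
      invFun := fun q => ⟨s q.2 (hfib q.2) q.1, by
        rw [Set.mem_preimage, hps]; exact q.1.2⟩
      left_inv := fun e => Subtype.ext ?_
      right_inv := fun q => ?_
      continuous_toFun := ?_
      continuous_invFun := ?_ }, fun _ => rfl⟩
  · simp only [hback, hse]
  · have h1 : s (s q.2 (hfib q.2) q.1) (by rw [hps]; exact q.1.2) = s q.2 (hfib q.2) :=
      heq _ _ (hsc _ _) (hsc _ _) (hps _ _) (hps _ _) q.1
        (hse' _ _ _ (hps _ _ _))
    refine Prod.ext (Subtype.ext (hps _ _ _)) (Subtype.ext ?_)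
    simp only [h1, hval]
  · refine Continuous.prodMk (by fun_prop) ?_
    refine IsLocallyConstant.continuous ((IsLocallyConstant.iff_eventually_eq _).2 fun e => ?_)
    obtain ⟨W, hW, heW, hWinj⟩ := hinj e
    have hcont : Continuous fun e' : p ⁻¹' V => s e e.2 ⟨p e', e'.2⟩ :=
      (hsc e e.2).comp (by fun_prop)
    have h1 : ∀ᶠ e' : p ⁻¹' V in nhds e, s e e.2 ⟨p e', e'.2⟩ ∈ W :=
      hcont.continuousAt.eventually_mem (hW.mem_nhds (by rwa [hse]))
    have h2 : ∀ᶠ e' : p ⁻¹' V in nhds e, (e' : E) ∈ W :=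
      continuous_subtype_val.continuousAt.eventually_mem (hW.mem_nhds heW)
    filter_upwards [h1, h2] with e' h1 h2
    have h3 : s e e.2 ⟨p e', e'.2⟩ = e' := hWinj h1 h2 (hps _ _ _)
    have h4 : s e' e'.2 = s e e.2 := heq _ _ (hsc _ _) (hsc _ _) (hps _ _) (hps _ _)
      ⟨p e', e'.2⟩ (by rw [hse, h3])
    exact Subtype.ext (by simp only [h4])
  · exact Continuous.subtype_mk ((continuous_prod_of_discrete_right
      (f := fun q : V × (p ⁻¹' {x} : Set E) => s q.2 (hfib q.2) q.1)).2
        fun i => hsc i (hfib i)) _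

namespace HasBallSections

variable {f : ℂ → ℂ} {U Ω : Set ℂ}

theorem isCoveringMap (h : HasBallSections f U Ω) (hU : IsOpen U) (hΩ : IsOpen Ω) :
    IsCoveringMap (Set.MapsTo.restrict f U Ω h.mapsTo) := by
  refine isCoveringMap_of_exists_section
    (h.differentiableOn.continuousOn.mapsToRestrict h.mapsTo) (T2Space.isSeparatedMap _) ?_ ?_
  · rw [isLocallyInjective_iff_nhds]
    intro z
    have hstrict : HasStrictDerivAt f (deriv f z) z :=
      (h.differentiableOn.analyticOnNhd hU z z.2).hasStrictDerivAt
    have hd : deriv f z ≠ 0 := h.deriv_ne_zero hU hΩ z.2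
    let e := (hstrict.hasStrictFDerivAt_equiv hd).toOpenPartialHomeomorph f
    refine ⟨(↑) ⁻¹' e.source, continuous_subtype_val.continuousAt.preimage_mem_nhds
      (e.open_source.mem_nhds (hstrict.hasStrictFDerivAt_equiv hd).mem_toOpenPartialHomeomorph_source),
      fun a ha b hb hab => ?_⟩
    exact Subtype.ext (e.injOn ha hb (congrArg Subtype.val hab))
  · intro x
    obtain ⟨r, hr, hrΩ⟩ := Metric.nhds_basis_closedBall.mem_iff.1 (hΩ.mem_nhds x.2)
    refine ⟨(↑) ⁻¹' Metric.ball (x : ℂ) r, Metric.isOpen_ball.preimage continuous_subtype_val,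
      Metric.mem_ball_self hr, ?_, fun e he => ?_⟩
    · rw [← Topology.IsInducing.subtypeVal.isPreconnected_image, Subtype.image_preimage_coe,
        Set.inter_eq_right.2 (Metric.ball_subset_closedBall.trans hrΩ)]
      exact (convex_ball _ _).isPreconnected
    · obtain ⟨g, hgd, hgm, hfg, hgz⟩ := h.exists_section x r hrΩ e e.2 he
      refine ⟨fun y => ⟨g y, hgm y.2⟩, ?_, fun y => Subtype.ext (hfg _ y.2), Subtype.ext hgz⟩
      exact Continuous.subtype_mk (hgd.continuousOn.comp_continuous (by fun_prop) fun y => y.2) _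

theorem image_eq (h : HasBallSections f U Ω) (hU : U.Nonempty) (hΩ : IsOpen Ω)
    (hΩc : IsPreconnected Ω) : f '' U = Ω := by
  refine h.mapsTo.image_subset.antisymm ?_
  have hball : ∀ c r, Metric.closedBall c r ⊆ Ω → (Metric.ball c r ∩ f '' U).Nonempty →
      Metric.ball c r ⊆ f '' U := by
    rintro c r hcr ⟨_, hz', z, hz, rfl⟩ y hy
    obtain ⟨g, -, hgm, hfg, -⟩ := h.exists_section c r hcr z hz hz'
    exact ⟨g y, hgm hy, hfg y hy⟩
  have hopen : IsOpen (f '' U) := by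
    rw [Metric.isOpen_iff]
    rintro _ ⟨z, hz, rfl⟩
    obtain ⟨r, hr, hrΩ⟩ := Metric.nhds_basis_closedBall.mem_iff.1 (hΩ.mem_nhds (h.mapsTo hz))
    exact ⟨r, hr, hball _ r hrΩ ⟨_, Metric.mem_ball_self hr, z, hz, rfl⟩⟩
  refine hΩc.subset_of_closure_inter_subset hopen ?_ ?_
  · obtain ⟨z, hz⟩ := hU
    exact ⟨f z, h.mapsTo hz, z, hz, rfl⟩
  · rintro x ⟨hx, hxΩ⟩
    obtain ⟨r, hr, hrΩ⟩ := Metric.nhds_basis_closedBall.mem_iff.1 (hΩ.mem_nhds hxΩ)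
    exact hball x r hrΩ (mem_closure_iff.1 hx _ Metric.isOpen_ball (Metric.mem_ball_self hr))
      (Metric.mem_ball_self hr)

/-- A holomorphic map into `Ω₁` lifts to a map with disk sections over a larger open set. -/
theorem exists_lift {F : ℂ → ℂ} (hF : HasBallSections F (Metric.ball 0 1) Ω) (hΩ : IsOpen Ω)
    (hf : DifferentiableOn ℂ f (Metric.ball 0 1)) (hfm : Set.MapsTo f (Metric.ball 0 1) Ω)
    (h0 : F 0 = f 0) :
    ∃ k : ℂ → ℂ, DifferentiableOn ℂ k (Metric.ball 0 1) ∧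
      Set.MapsTo k (Metric.ball 0 1) (Metric.ball 0 1) ∧ k 0 = 0 ∧
      ∀ z ∈ Metric.ball 0 1, F (k z) = f z := by
  have hmem : (0 : ℂ) ∈ Metric.ball (0 : ℂ) 1 := Metric.mem_ball_self one_pos
  have hcontr : ContractibleSpace (Metric.ball (0 : ℂ) 1) :=
    (convex_ball (0 : ℂ) 1).contractibleSpace ⟨0, hmem⟩
  have hloc : LocallyPathConnectedSpace (Metric.ball (0 : ℂ) 1) :=
    Metric.isOpen_ball.locallyPathConnectedSpace
  obtain ⟨K, ⟨hK0, hK⟩, -⟩ :=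
    (hF.isCoveringMap Metric.isOpen_ball hΩ).existsUnique_continuousMap_lifts
      (A := Metric.ball (0 : ℂ) 1)
      ⟨Set.MapsTo.restrict f _ _ hfm, hf.continuousOn.mapsToRestrict hfm⟩ ⟨0, hmem⟩ ⟨0, hmem⟩
      (Subtype.ext h0)
  classical
  let k : ℂ → ℂ := fun z => if hz : z ∈ Metric.ball (0 : ℂ) 1 then K ⟨z, hz⟩ else 0
  have hk : ∀ z (hz : z ∈ Metric.ball (0 : ℂ) 1), k z = K ⟨z, hz⟩ := fun z hz => dif_pos hz
  have hkm : Set.MapsTo k (Metric.ball 0 1) (Metric.ball 0 1) := fun z hz => by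
    rw [hk z hz]; exact (K ⟨z, hz⟩).2
  have hFk : ∀ z ∈ Metric.ball 0 1, F (k z) = f z := fun z hz => by
    rw [hk z hz]; exact congrArg Subtype.val (congrFun hK ⟨z, hz⟩)
  have hkc : ContinuousOn k (Metric.ball 0 1) := by
    rw [continuousOn_iff_continuous_domRestrict]
    convert continuous_subtype_val.comp K.continuous using 1
    exact funext fun z => hk z z.2
  refine ⟨k, fun z hz => ?_, hkm, by rw [hk 0 hmem, hK0], hFk⟩
  have hFd : HasDerivAt F (deriv F (k z)) (k z) :=
    (hF.differentiableOn.differentiableAt (Metric.isOpen_ball.mem_nhds (hkm hz))).hasDerivAt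
  have hstrict : HasStrictDerivAt F (deriv F (k z)) (k z) :=
    (hF.differentiableOn.analyticOnNhd Metric.isOpen_ball _ (hkm hz)).hasStrictDerivAt
  have hd : deriv F (k z) ≠ 0 := hF.deriv_ne_zero Metric.isOpen_ball hΩ (hkm hz)
  have hkz : ContinuousAt k z := hkc.continuousAt (Metric.isOpen_ball.mem_nhds hz)
  have hfd : DifferentiableAt ℂ f z := hf.differentiableAt (Metric.isOpen_ball.mem_nhds hz)
  have hinv := (hstrict.to_localInverse hd).hasDerivAt.differentiableAt
  rw [hFk z hz] at hinv
  refine ((hinv.comp z hfd).congr_of_eventuallyEq ?_).differentiableWithinAt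
  filter_upwards [hkz.eventually (hstrict.hasStrictFDerivAt_equiv hd).eventually_left_inverse,
    Metric.isOpen_ball.mem_nhds hz] with y hy hy1
  rw [Function.comp_apply, ← hFk y hy1]
  exact hy.symm

end HasBallSections

theorem IsLocalMax.second_deriv_nonpos {φ φ' : ℝ → ℝ} {d x : ℝ} (h : IsLocalMax φ x)
    (hφ : ∀ᶠ t in nhds x, HasDerivAt φ (φ' t) t) (hφ' : HasDerivAt φ' d x) : d ≤ 0 := by
  by_contra! hd
  have h1 : deriv φ =ᶠ[nhds x] φ' := hφ.mono fun t ht => ht.deriv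
  have h2 : deriv (deriv φ) x = d := h1.deriv_eq.trans hφ'.deriv
  have hmin : IsLocalMin φ x := isLocalMin_of_deriv_deriv_pos (by rwa [h2])
    h.deriv_eq_zero hφ.self_of_nhds.continuousAt
  have hconst : φ =ᶠ[nhds x] fun _ => φ x := by
    filter_upwards [h, hmin] with t h3 h4 using le_antisymm h3 h4
  have h3 : deriv (deriv φ) x = 0 := by
    rw [hconst.deriv.deriv_eq]
    simp
  linarith

/-- The sum of a bilinear form over an orthogonal pair of vectors `p`, `I * p`. -/
theorem ContinuousLinearMap.apply_self_add_apply_I_mul (B : ℂ →L[ℝ] ℂ →L[ℝ] ℝ) (p : ℂ) :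
    B p p + B (p * Complex.I) (p * Complex.I) =
      ‖p‖ ^ 2 * (B 1 1 + B Complex.I Complex.I) := by
  have h1 : p = p.re • (1 : ℂ) + p.im • Complex.I := by
    simp [Complex.re_add_im]
  have h2 : p * Complex.I = p.re • Complex.I + (-p.im) • (1 : ℂ) := by
    apply Complex.ext <;> simp
  have h3 : ‖p‖ ^ 2 = p.re ^ 2 + p.im ^ 2 := by
    rw [Complex.sq_norm, Complex.normSq_apply]; ring
  have h4 : ∀ a b : ℝ, B (a • (1 : ℂ) + b • Complex.I) (a • (1 : ℂ) + b • Complex.I) +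
      B (a • Complex.I + (-b) • (1 : ℂ)) (a • Complex.I + (-b) • (1 : ℂ)) =
        (a ^ 2 + b ^ 2) * (B 1 1 + B Complex.I Complex.I) := fun a b => by
    simp only [map_add, map_smul, add_apply, smul_apply, smul_eq_mul]
    ring
  rw [h2, h3, ← h4, ← h1]

theorem laplacianOn_eq {w : ℂ → ℝ} {Ω : Set ℂ} (hΩ : IsOpen Ω) {z : ℂ} (hz : z ∈ Ω) :
    laplacianOn w Ω z = fderiv ℝ (fderiv ℝ w) z 1 1 +
      fderiv ℝ (fderiv ℝ w) z Complex.I Complex.I := by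
  have h : ∀ v, iteratedFDerivWithin ℝ 2 w Ω z ![v, v] = fderiv ℝ (fderiv ℝ w) z v v := by
    intro v
    rw [iteratedFDerivWithin_of_isOpen 2 hΩ hz, iteratedFDeriv_two_apply]
    simp
  rw [laplacianOn, h, h]

/-- Second derivatives along a line of a composition with a holomorphic map. -/
theorem hasDerivAt_comp_line {w : ℂ → ℝ} {f : ℂ → ℂ} {z e : ℂ} (hf : AnalyticAt ℂ f z)
    (hw : ContDiffAt ℝ 2 w (f z)) :
    (∀ᶠ t : ℝ in nhds 0, HasDerivAt (fun t : ℝ => w (f (z + t * e)))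
      (fderiv ℝ w (f (z + t * e)) (deriv f (z + t * e) * e)) t) ∧
    HasDerivAt (fun t : ℝ => fderiv ℝ w (f (z + t * e)) (deriv f (z + t * e) * e))
      (fderiv ℝ (fderiv ℝ w) (f z) (deriv f z * e) (deriv f z * e) +
        fderiv ℝ w (f z) (deriv (deriv f) z * (e * e))) 0 := by
  have hline : ∀ t : ℝ, HasDerivAt (fun t : ℝ => z + t * e) e t := fun t => by
    simpa using ((Complex.ofRealCLM.hasDerivAt (x := t)).mul_const e).const_add z
  have hcont : Filter.Tendsto (fun t : ℝ => z + t * e) (nhds 0) (nhds z) := by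
    simpa using (hline 0).continuousAt.tendsto
  have hcomp : ∀ {g : ℂ → ℂ} {t : ℝ}, AnalyticAt ℂ g (z + t * e) →
      HasDerivAt (fun t : ℝ => g (z + t * e)) (deriv g (z + t * e) * e) t := fun hg =>
    HasDerivAt.comp (h₂ := _) _ hg.differentiableAt.hasDerivAt (hline _)
  have hw1 : ∀ᶠ y in nhds (f z), DifferentiableAt ℝ w y :=
    (hw.eventually (by simp)).mono fun y hy => hy.differentiableAt (by simp)
  constructor
  · filter_upwards [hcont.eventually hf.eventually_analyticAt,
      (hf.continuousAt.tendsto.comp hcont).eventually hw1] with t h1 h2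
    exact h2.hasFDerivAt.comp_hasDerivAt t (hcomp h1)
  · have hz : z + ((0 : ℝ) : ℂ) * e = z := by simp
    have hfd : HasFDerivAt (fderiv ℝ w) (fderiv ℝ (fderiv ℝ w) (f z)) (f (z + ((0 : ℝ) : ℂ) * e)) := by
      rw [hz]
      exact ((hw.fderiv_right (m := 1) (by norm_num)).differentiableAt (by simp)).hasFDerivAt
    have h1 : HasDerivAt (fun t : ℝ => fderiv ℝ w (f (z + t * e)))
        (fderiv ℝ (fderiv ℝ w) (f z) (deriv f z * e)) 0 := by
      have := hfd.comp_hasDerivAt (0 : ℝ) (hcomp (by rwa [hz]))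
      rwa [hz] at this
    have h2 : HasDerivAt (fun t : ℝ => deriv f (z + t * e) * e) (deriv (deriv f) z * e * e) 0 := by
      have := (hcomp (t := 0) (g := deriv f) (by rw [hz]; exact hf.deriv)).mul_const e
      rwa [hz] at this
    have := h1.clm_apply h2
    simp only [hz] at this
    rwa [mul_assoc (deriv (deriv f) z)] at this

theorem hasDerivAt_log_quadratic {α β : ℝ} (hα : 0 < α) :
    (∀ᶠ t : ℝ in nhds 0, HasDerivAt (fun t : ℝ => Real.log (α - 2 * β * t - t ^ 2))
      ((-2 * β - 2 * t) / (α - 2 * β * t - t ^ 2)) t) ∧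
    HasDerivAt (fun t : ℝ => (-2 * β - 2 * t) / (α - 2 * β * t - t ^ 2))
      (-2 / α - 4 * β ^ 2 / α ^ 2) 0 := by
  have hg : ∀ t : ℝ, HasDerivAt (fun t : ℝ => α - 2 * β * t - t ^ 2) (-2 * β - 2 * t) t := by
    intro t
    refine (((hasDerivAt_id t).const_mul (2 * β)).const_sub α |>.sub
      ((hasDerivAt_id t).fun_pow 2)).congr_deriv ?_
    simp
  constructor
  · have : ∀ᶠ t : ℝ in nhds 0, α - 2 * β * t - t ^ 2 ≠ 0 :=
      (hg 0).continuousAt.eventually_ne (by simpa using hα.ne')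
    exact this.mono fun t ht => (hg t).log ht
  · have h1 : HasDerivAt (fun t : ℝ => -2 * β - 2 * t) (-2) 0 := by
      simpa using ((hasDerivAt_id (0 : ℝ)).const_mul 2).const_sub (-2 * β)
    refine (h1.div (hg 0) (by simpa using hα.ne')).congr_deriv ?_
    field_simp
    simp
    field_simp
    ring

/-- **Ahlfors' lemma** for the derivative at the origin of a locally injective holomorphic map of the
unit disk into a domain with a metric of curvature at most `-1`. -/
theorem norm_deriv_mul_exp_le_two {Ω : Set ℂ} (hΩ : IsOpen Ω) {w : ℂ → ℝ}
    (hw : ContDiffOn ℝ 2 w Ω) (hineq : ∀ z ∈ Ω, Real.exp (2 * w z) ≤ laplacianOn w Ω z)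
    {f : ℂ → ℂ} (hf : DifferentiableOn ℂ f (Metric.ball 0 1))
    (hfm : Set.MapsTo f (Metric.ball 0 1) Ω) (hf' : ∀ z ∈ Metric.ball 0 1, deriv f z ≠ 0) :
    ‖deriv f 0‖ * Real.exp (w (f 0)) ≤ 2 := by
  have hdf : DifferentiableOn ℂ (deriv f) (Metric.ball 0 1) := hf.deriv Metric.isOpen_ball
  obtain ⟨l, hld, hl⟩ := exists_holomorphic_log_ball hdf hf'
  have key : ∀ R : ℝ, 0 < R → R < 1 → ‖deriv f 0‖ * Real.exp (w (f 0)) * R ≤ 2 := by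
    intro R hR hR1
    have hsub : Metric.closedBall (0 : ℂ) R ⊆ Metric.ball 0 1 := Metric.closedBall_subset_ball hR1
    let T : ℂ → ℝ := fun z => ‖deriv f z‖ * Real.exp (w (f z)) * (R ^ 2 - ‖z‖ ^ 2)
    have hTc : ContinuousOn T (Metric.closedBall 0 R) := by
      refine ContinuousOn.mul (ContinuousOn.mul ?_ ?_) (by fun_prop)
      · exact (hdf.continuousOn.mono hsub).norm
      · exact Real.continuous_exp.comp_continuousOn
          (hw.continuousOn.comp (hf.continuousOn.mono hsub) (hfm.mono_left hsub))
    have h0mem : (0 : ℂ) ∈ Metric.closedBall (0 : ℂ) R := Metric.mem_closedBall_self hR.le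
    obtain ⟨z, hz, hmax⟩ := (isCompact_closedBall (0 : ℂ) R).exists_isMaxOn ⟨0, h0mem⟩ hTc
    have hT0 : T 0 = ‖deriv f 0‖ * Real.exp (w (f 0)) * R ^ 2 := by simp [T]
    have hTpos : 0 < T 0 := by
      have := norm_pos_iff.2 (hf' 0 (hsub h0mem))
      rw [hT0]; positivity
    have hTz : 0 < T z := hTpos.trans_le (hmax h0mem)
    have hz1 := hsub hz
    have hα : 0 < R ^ 2 - ‖z‖ ^ 2 :=
      pos_of_mul_pos_right hTz (by positivity)
    have hzR : z ∈ Metric.ball (0 : ℂ) R := by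
      rw [mem_ball_zero_iff]
      exact lt_of_pow_lt_pow_left₀ 2 hR.le (by linarith)
    set α := R ^ 2 - ‖z‖ ^ 2 with hαdef
    have hfz : AnalyticAt ℂ f z := hf.analyticOnNhd Metric.isOpen_ball z hz1
    have hlz : AnalyticAt ℂ l z := hld.analyticOnNhd Metric.isOpen_ball z hz1
    have hwz : ContDiffAt ℝ 2 w (f z) := hw.contDiffAt (hΩ.mem_nhds (hfm hz1))
    have hdir : ∀ e : ℂ, ‖e‖ = 1 →
        fderiv ℝ (fderiv ℝ w) (f z) (deriv f z * e) (deriv f z * e) +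
          fderiv ℝ w (f z) (deriv (deriv f) z * (e * e)) + (deriv (deriv l) z * (e * e)).re +
          (-2 / α - 4 * (z * (starRingEnd ℂ) e).re ^ 2 / α ^ 2) ≤ 0 := by
      intro e he
      obtain ⟨h1, h1'⟩ := hasDerivAt_comp_line (e := e) hfz hwz
      obtain ⟨h2, h2'⟩ := hasDerivAt_comp_line (e := e) (w := Complex.reCLM) hlz
        Complex.reCLM.contDiff.contDiffAt
      obtain ⟨h3, h3'⟩ := hasDerivAt_log_quadratic (β := (z * (starRingEnd ℂ) e).re) hα
      have hcont : Filter.Tendsto (fun t : ℝ => z + t * e) (nhds 0) (nhds z) := by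
        have : Continuous fun t : ℝ => z + t * e := by fun_prop
        simpa using this.tendsto 0
      have hquad : ∀ t : ℝ, R ^ 2 - ‖z + t * e‖ ^ 2 =
          α - 2 * (z * (starRingEnd ℂ) e).re * t - t ^ 2 := by
        intro t
        have he2 : e.re * e.re + e.im * e.im = 1 := by
          rw [← Complex.normSq_apply, ← Complex.sq_norm, he, one_pow]
        rw [hαdef]
        simp only [Complex.sq_norm, Complex.normSq_apply]
        simp
        linear_combination -t ^ 2 * he2
      have hlog : ∀ y ∈ Metric.ball (0 : ℂ) R,
          Real.log (T y) = w (f y) + Complex.reCLM (l y) + Real.log (R ^ 2 - ‖y‖ ^ 2) ∧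
            0 < T y := by
        intro y hy
        have hy1 := hsub (Metric.ball_subset_closedBall hy)
        have h4 : 0 < R ^ 2 - ‖y‖ ^ 2 := by
          rw [mem_ball_zero_iff] at hy
          have := pow_lt_pow_left₀ hy (norm_nonneg y) two_ne_zero
          linarith
        have h5 : ‖deriv f y‖ = Real.exp (l y).re := by rw [← hl y hy1, Complex.norm_exp]
        have h6 : T y = Real.exp ((l y).re + w (f y)) * (R ^ 2 - ‖y‖ ^ 2) := by
          simp only [T, h5, Real.exp_add]
        rw [h6]
        refine ⟨?_, by positivity⟩
        rw [Real.log_mul (Real.exp_ne_zero _) h4.ne', Real.log_exp, Complex.reCLM_apply]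
        ring
      refine IsLocalMax.second_deriv_nonpos (x := 0) ?_ (((h1.and (h2.and h3))).mono
        fun t ht => (ht.1.add ht.2.1).add ht.2.2) ?_
      · filter_upwards [hcont.eventually_mem (Metric.isOpen_ball.mem_nhds hzR)] with t ht
        obtain ⟨h7, h8⟩ := hlog _ ht
        obtain ⟨h9, h10⟩ := hlog _ hzR
        have h11 := Real.log_le_log h8 (hmax (Metric.ball_subset_closedBall ht))
        rw [h7, h9, hquad] at h11
        simpa [← hαdef] using h11
      · refine ((h1'.add h2').add h3').congr_deriv ?_
        have h4 : fderiv ℝ (Complex.reCLM : ℂ → ℝ) = fun _ => Complex.reCLM :=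
          funext fun _ => Complex.reCLM.fderiv
        simp [h4]
    have hsum := add_le_add (hdir 1 (by simp)) (hdir Complex.I (by simp))
    have hB := ContinuousLinearMap.apply_self_add_apply_I_mul (fderiv ℝ (fderiv ℝ w) (f z))
      (deriv f z)
    have hlap := hineq _ (hfm hz1)
    rw [laplacianOn_eq hΩ (hfm hz1)] at hlap
    have hβ : z.re ^ 2 + z.im ^ 2 = ‖z‖ ^ 2 := by
      rw [Complex.sq_norm, Complex.normSq_apply]; ring
    simp [Complex.I_mul_I] at hsum
    have h4 : ‖deriv f z‖ ^ 2 * Real.exp (2 * w (f z)) ≤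
        ‖deriv f z‖ ^ 2 * (fderiv ℝ (fderiv ℝ w) (f z) 1 1 +
          fderiv ℝ (fderiv ℝ w) (f z) Complex.I Complex.I) := by gcongr
    have h5 : (-2 / α - 4 * z.re ^ 2 / α ^ 2) + (-2 / α - 4 * z.im ^ 2 / α ^ 2) =
        -((2 * R) ^ 2 / α ^ 2) := by
      have : R ^ 2 = α + (z.re ^ 2 + z.im ^ 2) := by rw [hβ]; ring
      field_simp
      linear_combination 4 * this
    have h6 : ‖deriv f z‖ ^ 2 * Real.exp (2 * w (f z)) ≤ (2 * R) ^ 2 / α ^ 2 := by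
      linarith
    have h7 : T z ≤ 2 * R := by
      refine le_of_sq_le_sq ?_ (by positivity)
      rw [le_div_iff₀ (by positivity)] at h6
      have h8 : Real.exp (2 * w (f z)) = Real.exp (w (f z)) ^ 2 := by
        rw [← Real.exp_nat_mul]; norm_num
      simp only [T]
      rw [mul_pow, mul_pow, ← h8]
      exact h6
    have h8 : T 0 ≤ 2 * R := (hmax h0mem).trans h7
    rw [hT0] at h8
    refine le_of_mul_le_mul_right (a := R) ?_ hR
    linarith
  by_contra! hlt
  obtain ⟨R, h1, h2⟩ := exists_between ((div_lt_one (by linarith)).2 hlt)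
  have hpos : 0 < ‖deriv f 0‖ * Real.exp (w (f 0)) := by linarith
  have h3 := key R (lt_trans (by positivity) h1) h2
  rw [div_lt_iff₀ hpos] at h1
  linarith

/-- A self-map of the disk fixing the origin whose derivative there is close to unimodular covers
a given smaller disk. -/
theorem exists_forall_ball_subset_image {r : ℝ} (hr0 : 0 < r) (hr1 : r < 1) :
    ∃ ε > 0, ∃ r' < 1, ∀ h : ℂ → ℂ, DifferentiableOn ℂ h (Metric.ball 0 1) →
      Set.MapsTo h (Metric.ball 0 1) (Metric.ball 0 1) → h 0 = 0 → 1 - ε < ‖deriv h 0‖ →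
      Metric.ball 0 r ⊆ h '' Metric.closedBall 0 r' := by
  by_contra! hcon
  have hex : ∀ n : ℕ, ∃ h : ℂ → ℂ, DifferentiableOn ℂ h (Metric.ball 0 1) ∧
      Set.MapsTo h (Metric.ball 0 1) (Metric.ball 0 1) ∧ h 0 = 0 ∧
      1 - 1 / ((n : ℝ) + 1) < ‖deriv h 0‖ ∧
      ∃ c ∈ Metric.ball 0 r, ∀ z ∈ Metric.closedBall 0 ((1 + r) / 2), h z ≠ c := by
    intro n
    obtain ⟨h, h1, h2, h3, h4, h5⟩ :=
      hcon (1 / ((n : ℝ) + 1)) Nat.one_div_pos_of_nat ((1 + r) / 2) (by linarith)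
    obtain ⟨c, hc, hc'⟩ := Set.not_subset.1 h5
    exact ⟨h, h1, h2, h3, h4, c, hc, fun z hz hzc => hc' ⟨z, hz, hzc⟩⟩
  choose h hd hm h0 hder c hc hne using hex
  let φ : Ultrafilter ℕ := Filter.hyperfilter ℕ
  have hφ : (φ : Filter ℕ) ≤ Filter.atTop := Nat.cofinite_eq_atTop ▸ Filter.hyperfilter_le_cofinite
  have h0mem : (0 : ℂ) ∈ Metric.ball (0 : ℂ) 1 := Metric.mem_ball_self one_pos
  obtain ⟨H, hH⟩ := exists_tendstoLocallyUniformlyOn_of_locally_bounded φ (F := h)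
    (U := Metric.ball 0 1) fun x hx => by
      obtain ⟨ρ, hρ, hsub⟩ := Metric.isOpen_iff.1 Metric.isOpen_ball x hx
      exact ⟨ρ, hρ, 1, Filter.Eventually.of_forall fun n => ⟨(hd n).mono hsub, fun z hz =>
        (mem_ball_zero_iff.1 (hm n (hsub hz))).le⟩⟩
  have hHd : DifferentiableOn ℂ H (Metric.ball 0 1) :=
    hH.differentiableOn (Filter.Eventually.of_forall hd) Metric.isOpen_ball
  have hH0 : H 0 = 0 := tendsto_nhds_unique (hH.tendsto_at h0mem)
    (by simp only [h0]; exact tendsto_const_nhds)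
  have hHm : Set.MapsTo H (Metric.ball 0 1) (Metric.closedBall (H 0) 1) := fun z hz => by
    rw [hH0, mem_closedBall_zero_iff]
    exact le_of_tendsto (hH.tendsto_at hz).norm
      (Filter.Eventually.of_forall fun n => (mem_ball_zero_iff.1 (hm n hz)).le)
  have hH1 : ‖deriv H 0‖ = 1 := by
    refine le_antisymm ?_ ?_
    · simpa using Complex.norm_deriv_le_div_of_mapsTo_ball hHd hHm one_pos
    · have h1 : Filter.Tendsto (fun n : ℕ => 1 - 1 / ((n : ℝ) + 1)) φ (nhds (1 - 0)) :=
        (tendsto_const_nhds.sub tendsto_one_div_add_atTop_nhds_zero_nat).mono_left hφ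
      rw [sub_zero] at h1
      exact le_of_tendsto_of_tendsto' h1
        ((hH.deriv (Filter.Eventually.of_forall hd) Metric.isOpen_ball).tendsto_at h0mem).norm
        fun n => (hder n).le
  have haff := Complex.affine_of_mapsTo_ball_of_norm_dslope_eq_div hHd hHm h0mem
    (by rw [dslope_same, hH1, div_one])
  simp only [dslope_same, hH0, sub_zero, zero_add, smul_eq_mul] at haff
  have hder0 : deriv H 0 ≠ 0 := norm_pos_iff.1 (by rw [hH1]; exact one_pos)
  obtain ⟨c₀, hc₀, hlim⟩ := (isCompact_closedBall (0 : ℂ) r).ultrafilter_le_nhds (φ.map c) (by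
    rw [Filter.le_principal_iff]
    exact Filter.Eventually.of_forall (p := fun n => c n ∈ Metric.closedBall (0 : ℂ) r)
      (fun n => Metric.ball_subset_closedBall (hc n)))
  have hlim' : Filter.Tendsto c φ (nhds c₀) := hlim
  rw [mem_closedBall_zero_iff] at hc₀
  have hsub : Metric.ball (0 : ℂ) ((1 + r) / 2) ⊆ Metric.ball 0 1 :=
    Metric.ball_subset_ball (by linarith)
  have hz₀ : c₀ / deriv H 0 ∈ Metric.ball (0 : ℂ) ((1 + r) / 2) := by
    rw [mem_ball_zero_iff, norm_div, hH1, div_one]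
    linarith
  have hmid : ((r / 2 : ℝ) : ℂ) ∈ Metric.ball (0 : ℂ) ((1 + r) / 2) := by
    rw [mem_ball_zero_iff, Complex.norm_real, Real.norm_of_nonneg (by linarith)]
    linarith
  refine ne_zero_of_tendstoLocallyUniformlyOn_of_ne_zero Metric.isOpen_ball
    (convex_ball (0 : ℂ) ((1 + r) / 2)).isPreconnected
    ((hH.mono hsub).sub_tendsto_const hlim') (fun x hx => ?_) ?_ hz₀ ?_
  · obtain ⟨ρ, hρ, hsub'⟩ := Metric.isOpen_iff.1 Metric.isOpen_ball x hx
    exact ⟨ρ, hρ, Filter.Eventually.of_forall fun n =>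
      ⟨((hd n).mono (hsub'.trans hsub)).sub_const _, fun y hy =>
        sub_ne_zero.2 (hne n y (Metric.ball_subset_closedBall (hsub' hy)))⟩⟩
  · by_cases hc0 : c₀ = 0
    · refine ⟨_, hmid, ?_⟩
      rw [haff (hsub hmid), hc0, sub_zero]
      exact mul_ne_zero (by exact_mod_cast (half_pos hr0).ne') hder0
    · exact ⟨0, Metric.mem_ball_self (by linarith), by rwa [hH0, zero_sub, neg_ne_zero]⟩
  · rw [haff (hsub hz₀)]
    exact sub_eq_zero.2 (div_mul_cancel₀ _ hder0)

theorem exists_hasBallSections {Ω : Set ℂ} (hΩ : IsOpen Ω) {a : ℂ} (ha : a ∈ Ω) {w : ℂ → ℝ}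
    (hw : ContDiffOn ℝ 2 w Ω) (hineq : ∀ z ∈ Ω, Real.exp (2 * w z) ≤ laplacianOn w Ω z) :
    ∃ f : ℂ → ℂ, HasBallSections f (Metric.ball 0 1) Ω := by
  let V : ℕ → Set ℂ := fun n => Ω ∩ Metric.ball 0 (‖a‖ + 1 + n)
  have hVo : ∀ n, IsOpen (V n) := fun n => hΩ.inter Metric.isOpen_ball
  have hVmono : Monotone V := fun m n hmn => Set.inter_subset_inter_right _
    (Metric.ball_subset_ball (by gcongr))
  have hVa : ∀ n, a ∈ V n := fun n => ⟨ha, by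
    rw [mem_ball_zero_iff]
    have : (0 : ℝ) ≤ n := n.cast_nonneg
    linarith⟩
  have hex : ∀ n, ∃ f : ℂ → ℂ, HasBallSections f (Metric.ball 0 1) (V n) ∧ f 0 = a := fun n =>
    exists_hasBallSections_of_isBounded (hVo n)
      (Metric.isBounded_ball.subset Set.inter_subset_right) (hVa n)
  choose f hf hf0 using hex
  have h0mem : (0 : ℂ) ∈ Metric.ball (0 : ℂ) 1 := Metric.mem_ball_self one_pos
  have hlift : ∀ m n, m ≤ n → ∃ k : ℂ → ℂ, DifferentiableOn ℂ k (Metric.ball 0 1) ∧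
      Set.MapsTo k (Metric.ball 0 1) (Metric.ball 0 1) ∧ k 0 = 0 ∧
      (∀ z ∈ Metric.ball 0 1, f n (k z) = f m z) ∧
      ‖deriv (f m) 0‖ = ‖deriv (f n) 0‖ * ‖deriv k 0‖ := by
    intro m n hmn
    obtain ⟨k, hkd, hkm, hk0, hk⟩ := (hf n).exists_lift (hVo n) (hf m).differentiableOn
      ((hf m).mapsTo.mono_right (hVmono hmn)) ((hf0 n).trans (hf0 m).symm)
    refine ⟨k, hkd, hkm, hk0, hk, ?_⟩
    have h1 : HasDerivAt k (deriv k 0) 0 :=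
      (hkd.differentiableAt (Metric.isOpen_ball.mem_nhds h0mem)).hasDerivAt
    have h2 : HasDerivAt (f n) (deriv (f n) 0) (k 0) := by
      rw [hk0]
      exact ((hf n).differentiableOn.differentiableAt
        (Metric.isOpen_ball.mem_nhds h0mem)).hasDerivAt
    have h3 : f n ∘ k =ᶠ[nhds 0] f m :=
      Filter.eventuallyEq_of_mem (Metric.isOpen_ball.mem_nhds h0mem) hk
    rw [← h3.deriv_eq, (h2.comp 0 h1).deriv, norm_mul]
  have hpos : ∀ n, 0 < ‖deriv (f n) 0‖ := fun n =>
    norm_pos_iff.2 ((hf n).deriv_ne_zero Metric.isOpen_ball (hVo n) h0mem)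
  have hbdd : BddAbove (Set.range fun n => ‖deriv (f n) 0‖) := by
    refine ⟨2 / Real.exp (w a), ?_⟩
    rintro _ ⟨n, rfl⟩
    rw [le_div_iff₀ (Real.exp_pos _), ← hf0 n]
    exact norm_deriv_mul_exp_le_two hΩ hw hineq (hf n).differentiableOn
      ((hf n).mapsTo.mono_right Set.inter_subset_left)
      fun z hz => (hf n).deriv_ne_zero Metric.isOpen_ball (hVo n) hz
  set L := ⨆ n, ‖deriv (f n) 0‖ with hL
  have hdL : ∀ n, ‖deriv (f n) 0‖ ≤ L := le_ciSup hbdd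
  have hL0 : 0 < L := (hpos 0).trans_le (hdL 0)
  have hcompact : ∀ r < 1, ∃ K ⊆ Ω, IsCompact K ∧
      ∀ᶠ n in Filter.atTop, Set.MapsTo (f n) (Metric.ball 0 r) K := by
    intro r hr1
    rcases le_or_gt r 0 with hr0 | hr0
    · exact ⟨∅, Set.empty_subset _, isCompact_empty, by
        simp [Metric.ball_eq_empty.2 hr0]⟩
    obtain ⟨ε, hε, r', hr', hQ⟩ := exists_forall_ball_subset_image hr0 hr1
    obtain ⟨N, hN⟩ := exists_lt_of_lt_ciSup (show (1 - ε) * L < L by nlinarith)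
    have hsub : Metric.closedBall (0 : ℂ) r' ⊆ Metric.ball 0 1 :=
      Metric.closedBall_subset_ball hr'
    refine ⟨f N '' Metric.closedBall 0 r', ?_,
      (isCompact_closedBall _ _).image_of_continuousOn
        ((hf N).differentiableOn.continuousOn.mono hsub), ?_⟩
    · rintro _ ⟨z, hz, rfl⟩
      exact ((hf N).mapsTo (hsub hz)).1
    · filter_upwards [Filter.eventually_ge_atTop N] with n hn z hz
      obtain ⟨k, hkd, hkm, hk0, hk, hder⟩ := hlift N n hn
      have h1 : 1 - ε < ‖deriv k 0‖ := by
        refine lt_of_mul_lt_mul_right (hN.trans_le ?_) hL0.le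
        rw [hder, mul_comm]
        gcongr
        exact hdL n
      obtain ⟨y, hy, rfl⟩ := hQ k hkd hkm hk0 h1 hz
      exact ⟨y, hy, (hk y (hsub hy)).symm⟩
  let φ : Ultrafilter ℕ := Filter.hyperfilter ℕ
  have hφ : (φ : Filter ℕ) ≤ Filter.atTop := Nat.cofinite_eq_atTop ▸ Filter.hyperfilter_le_cofinite
  have hK : ∀ x ∈ Metric.ball (0 : ℂ) 1, ∃ r > 0, Metric.ball x r ⊆ Metric.ball 0 1 ∧ ∃ K ⊆ Ω,
      IsCompact K ∧ ∀ᶠ n in (φ : Filter ℕ), Set.MapsTo (f n) (Metric.ball x r) K := by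
    intro x hx
    rw [mem_ball_zero_iff] at hx
    obtain ⟨K, hKΩ, hKc, hK⟩ := hcompact ((1 + ‖x‖) / 2) (by linarith)
    have hK' : ∀ᶠ n in (φ : Filter ℕ), Set.MapsTo (f n) (Metric.ball 0 ((1 + ‖x‖) / 2)) K := hφ hK
    refine ⟨(1 - ‖x‖) / 2, by linarith,
      Metric.ball_subset_ball' (by rw [dist_zero_right]; linarith), K, hKΩ, hKc,
      hK'.mono fun n hn => hn.mono_left
        (Metric.ball_subset_ball' (by rw [dist_zero_right]; linarith))⟩
  obtain ⟨F, hF⟩ := exists_tendstoLocallyUniformlyOn_of_locally_bounded φ (F := f)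
    (U := Metric.ball 0 1) fun x hx => by
      obtain ⟨r, hr, hsub, K, -, hKc, hK⟩ := hK x hx
      obtain ⟨M, hM⟩ := hKc.isBounded.exists_norm_le
      exact ⟨r, hr, M, hK.mono fun n hn =>
        ⟨(hf n).differentiableOn.mono hsub, fun z hz => hM _ (hn hz)⟩⟩
  refine ⟨F, HasBallSections.of_tendstoLocallyUniformlyOn φ (fun _ => subset_rfl)
    (fun r hr => Filter.Eventually.of_forall fun _ => Metric.ball_subset_ball hr.le) hf ?_ hF ?_⟩
  · intro c r hcr
    obtain ⟨R, hR⟩ := (Metric.isBounded_closedBall (x := c) (r := r)).subset_ball 0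
    obtain ⟨N, hN⟩ := exists_nat_ge R
    refine hφ ((Filter.eventually_ge_atTop N).mono fun n hn => Set.subset_inter hcr
      (hR.trans (Metric.ball_subset_ball ?_)))
    have : (N : ℝ) ≤ n := by exact_mod_cast hn
    have := norm_nonneg a
    linarith
  · intro z hz
    obtain ⟨r, hr, -, K, hKΩ, hKc, hK⟩ := hK z hz
    exact hKΩ (hKc.isClosed.mem_of_tendsto (hF.tendsto_at hz)
      (hK.mono fun n hn => hn (Metric.mem_ball_self hr)))

/-- If a nonempty open connected set `Ω ⊆ ℂ` carries a C² function `w` with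
`Δw ≥ e^{2w}` (a conformal metric of Gaussian curvature ≤ -1), then `Ω` is
holomorphically covered by the unit disk. -/
theorem covered_by_disk_of_negative_curvature
    (Ω : Set ℂ) (hne : Ω.Nonempty) (hopen : IsOpen Ω) (hconn : IsConnected Ω)
    (w : ℂ → ℝ) (hw : ContDiffOn ℝ 2 w Ω)
    (hineq : ∀ z ∈ Ω, Real.exp (2 * w z) ≤ laplacianOn w Ω z) :
    ∃ f : ℂ → ℂ, IsHolomorphicCoveringOnto f (Metric.ball 0 1) Ω := by
  obtain ⟨a, ha⟩ := hne
  obtain ⟨f, hf⟩ := exists_hasBallSections hopen ha hw hineq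
  exact ⟨f, hf.differentiableOn,
    hf.image_eq ⟨0, Metric.mem_ball_self one_pos⟩ hopen hconn.isPreconnected,
    fun _ => hf.isCoveringMap Metric.isOpen_ball hopen⟩
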